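/- Under the two-level hierarchical linear regression model, for each child i, E[(θ̂ᵇ_i − p_i θ̂₀)ᵀ Σ (θ̂ᵇ_i − p_i θ̂₀)] = s_i · E[ Σ_{j=1}^n ((θ₀ᵀx_j)² + η_j²) · x_jᵀ S^{-1} Σ S^{-1} x_j ]. -/

import Mathlib

open MeasureTheory ProbabilityTheory Matrix Finset

noncomputable section

/-- The product of `d` independent standard Gaussians on `Fin d → ℝ`. -/
def stdGaussianPi (d : ℕ) : Measure (Fin d → ℝ) :=
  Measure.pi fun _ => gaussianReal 0 1

/-- `μ` is the centered multivariate Gaussian distribution on `ℝ^d` with covariance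
matrix `C`, i.e. the law of `A z` where `z` is a standard Gaussian vector and `A Aᵀ = C`. -/
def IsCenteredGaussian {d : ℕ} (μ : Measure (Fin d → ℝ))
    (C : Matrix (Fin d) (Fin d) ℝ) : Prop :=
  ∃ A : Matrix (Fin d) (Fin d) ℝ, A * Aᵀ = C ∧ μ = (stdGaussianPi d).map (fun z => A.mulVec z)

/-- Sample space for the two-level hierarchical linear regression model with `n` time steps:
a point `ω = (x, η, a)` records the covariates `x t : ℝ^d`, the noises `η t : ℝ`, and the
proportion vectors `a t : ℝ^K`, for `t = 1, …, n`. -/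
abbrev HierOmega (d n K : ℕ) : Type :=
  (Fin n → (Fin d → ℝ)) × (Fin n → ℝ) × (Fin n → (Fin K → ℝ))

/-- The joint law of the model: the covariates are i.i.d. with law `νx`, the noises are
i.i.d. with law `νη`, the proportion vectors are i.i.d. with law `νa`, and the three
families are mutually independent. -/
def hierMeasure (d n K : ℕ) (νx : Measure (Fin d → ℝ)) (νη : Measure ℝ)
    (νa : Measure (Fin K → ℝ)) : Measure (HierOmega d n K) :=
  (Measure.pi fun _ : Fin n => νx).prod
    ((Measure.pi fun _ : Fin n => νη).prod (Measure.pi fun _ : Fin n => νa))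

variable {d n K : ℕ}

/-- The empirical second-moment matrix `S = ∑ t, x_t x_tᵀ`. -/
def Smat (ω : HierOmega d n K) : Matrix (Fin d) (Fin d) ℝ :=
  ∑ t, vecMulVec (ω.1 t) (ω.1 t)

/-- The root value at time `t`: `y_{t,0} = θ₀ᵀ x_t + η_t`. -/
def yRoot (θ₀ : Fin d → ℝ) (t : Fin n) (ω : HierOmega d n K) : ℝ :=
  θ₀ ⬝ᵥ ω.1 t + ω.2.1 t

/-- The value of child `i` at time `t`: `y_{t,i} = a_{t,i} · y_{t,0}`. -/
def yChild (θ₀ : Fin d → ℝ) (i : Fin K) (t : Fin n) (ω : HierOmega d n K) : ℝ :=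
  ω.2.2 t i * yRoot θ₀ t ω

/-- The bottom-up OLS estimator for child `i`: `θ̂ᵇ_i = S⁻¹ ∑ t, x_t y_{t,i}`. -/
def thetaBU (θ₀ : Fin d → ℝ) (i : Fin K) (ω : HierOmega d n K) : Fin d → ℝ :=
  (Smat ω)⁻¹.mulVec (∑ t, yChild θ₀ i t ω • ω.1 t)

/-- The root OLS estimator `θ̂₀ = S⁻¹ ∑ t, x_t y_{t,0}`. -/
def thetaRoot (θ₀ : Fin d → ℝ) (ω : HierOmega d n K) : Fin d → ℝ :=
  (Smat ω)⁻¹.mulVec (∑ t, yRoot θ₀ t ω • ω.1 t)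

/-- The estimated proportion `p̂_i = (1/n) ∑ t, a_{t,i}`. -/
def pHat (i : Fin K) (ω : HierOmega d n K) : ℝ :=
  (∑ t, ω.2.2 t i) / n

/-- The top-down estimator for child `i`: `θ̂ᵗ_i = p̂_i θ̂₀`. -/
def thetaTD (θ₀ : Fin d → ℝ) (i : Fin K) (ω : HierOmega d n K) : Fin d → ℝ :=
  pHat i ω • thetaRoot θ₀ ω

/-- The excess risk of an estimate `est` for the target coefficient vector `tgt`,
with respect to the covariance `C`: `(est − tgt)ᵀ C (est − tgt)`. -/
def excessRisk (C : Matrix (Fin d) (Fin d) ℝ) (tgt est : Fin d → ℝ) : ℝ :=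
  (est - tgt) ⬝ᵥ C.mulVec (est - tgt)

/-- The weights `(G⁻¹ x_j)ᵀ C (G⁻¹ x_k)`, where `G = ∑ t, x_t x_tᵀ`. -/
def olsWeight (C : Matrix (Fin d) (Fin d) ℝ) (x : Fin n → Fin d → ℝ) (j k : Fin n) : ℝ :=
  ((∑ t, vecMulVec (x t) (x t))⁻¹ *ᵥ x j) ⬝ᵥ C *ᵥ ((∑ t, vecMulVec (x t) (x t))⁻¹ *ᵥ x k)

lemma measurable_olsWeight (C : Matrix (Fin d) (Fin d) ℝ) (j k : Fin n) :
    Measurable fun x : Fin n → Fin d → ℝ => olsWeight C x j k := by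
  have hG : Continuous fun x : Fin n → Fin d → ℝ => ∑ t, vecMulVec (x t) (x t) :=
    continuous_finsetSum _ fun t _ => (continuous_apply t).matrix_vecMulVec (continuous_apply t)
  have hinv (a b : Fin d) : Measurable fun x : Fin n → Fin d → ℝ =>
      (∑ t, vecMulVec (x t) (x t))⁻¹ a b := by
    simp only [Matrix.inv_def, Ring.inverse_eq_inv', Matrix.smul_apply, smul_eq_mul]
    exact hG.matrix_det.measurable.inv.mul (hG.matrix_adjugate.matrix_elem a b).measurable
  have hmulVec (j : Fin n) (a : Fin d) : Measurable fun x : Fin n → Fin d → ℝ =>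
      ((∑ t, vecMulVec (x t) (x t))⁻¹ *ᵥ x j) a := by
    simp only [mulVec, dotProduct]
    refine Finset.measurable_fun_sum _ fun b _ => ?_
    exact (hinv a b).fun_mul (by fun_prop)
  simp only [olsWeight, dotProduct]
  refine Finset.measurable_fun_sum _ fun a _ => (hmulVec j a).fun_mul ?_
  simp only [mulVec.eq_1 C, dotProduct]
  exact Finset.measurable_fun_sum _ fun b _ => (hmulVec k b).const_mul _

lemma olsWeight_self_nonneg {C : Matrix (Fin d) (Fin d) ℝ} (hC : C.PosSemidef)
    (x : Fin n → Fin d → ℝ) (j : Fin n) : 0 ≤ olsWeight C x j j := by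
  simpa [olsWeight] using hC.dotProduct_mulVec_nonneg ((∑ t, vecMulVec (x t) (x t))⁻¹ *ᵥ x j)

lemma olsWeight_self (C : Matrix (Fin d) (Fin d) ℝ) (ω : HierOmega d n K) (j : Fin n) :
    ω.1 j ⬝ᵥ ((Smat ω)⁻¹ * C * (Smat ω)⁻¹) *ᵥ ω.1 j = olsWeight C ω.1 j j := by
  have hsymm : ((Smat ω)⁻¹)ᵀ = (Smat ω)⁻¹ := by
    simp [Smat, transpose_nonsing_inv, transpose_sum, transpose_vecMulVec]
  change _ = ((Smat ω)⁻¹ *ᵥ ω.1 j) ⬝ᵥ C *ᵥ ((Smat ω)⁻¹ *ᵥ ω.1 j)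
  rw [← mulVec_mulVec, ← mulVec_mulVec, dotProduct_mulVec, ← mulVec_transpose, hsymm]

lemma thetaBU_sub_quadForm (C : Matrix (Fin d) (Fin d) ℝ) (θ₀ : Fin d → ℝ) (i : Fin K) (r : ℝ)
    (ω : HierOmega d n K) :
    (thetaBU θ₀ i ω - r • thetaRoot θ₀ ω) ⬝ᵥ C *ᵥ (thetaBU θ₀ i ω - r • thetaRoot θ₀ ω) =
      ∑ j, ∑ k, (ω.2.2 j i - r) * (ω.2.2 k i - r) *
        (yRoot θ₀ j ω * yRoot θ₀ k ω * olsWeight C ω.1 j k) := by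
  have h : thetaBU θ₀ i ω - r • thetaRoot θ₀ ω =
      ∑ t, ((ω.2.2 t i - r) * yRoot θ₀ t ω) • (Smat ω)⁻¹ *ᵥ ω.1 t := by
    simp only [thetaBU, thetaRoot, yChild, mulVec_sum, mulVec_smul, Finset.smul_sum, smul_smul,
      ← Finset.sum_sub_distrib, ← sub_smul, sub_mul]
  rw [h]
  simp only [mulVec_sum, mulVec_smul, dotProduct_sum, sum_dotProduct, smul_dotProduct,
    dotProduct_smul, smul_eq_mul, olsWeight, Smat, Finset.mul_sum]
  rw [Finset.sum_comm]
  exact Finset.sum_congr rfl fun j _ => Finset.sum_congr rfl fun k _ => by ring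

/-- For a centered law, the second moment of `c + e` equals that of `c² + e²`, in `ℝ≥0∞` and hence
without any integrability assumption. -/
lemma lintegral_const_add_sq (ν : Measure ℝ) [IsProbabilityMeasure ν] (hmean : ∫ e, e ∂ν = 0)
    (c : ℝ) :
    ∫⁻ e, ENNReal.ofReal ((c + e) ^ 2) ∂ν = ∫⁻ e, ENNReal.ofReal (c ^ 2 + e ^ 2) ∂ν := by
  by_cases h : MemLp (fun e : ℝ => e) 2 ν
  · have hsq : Integrable (fun e : ℝ => e ^ 2) ν := h.integrable_sq
    have hid : Integrable (fun e : ℝ => e) ν := h.integrable (by norm_num)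
    have hadd : Integrable (fun e : ℝ => (c + e) ^ 2) ν := ((memLp_const c).add h).integrable_sq
    have hsum : Integrable (fun e : ℝ => c ^ 2 + e ^ 2) ν := (integrable_const _).add hsq
    rw [← ofReal_integral_eq_lintegral_ofReal hadd
        (ae_of_all _ fun e => sq_nonneg _),
      ← ofReal_integral_eq_lintegral_ofReal hsum
        (ae_of_all _ fun e => by positivity)]
    congr 1
    have hexp (e : ℝ) : (c + e) ^ 2 = (c ^ 2 + e ^ 2) + 2 * c * e := by ring
    simp only [hexp]
    rw [integral_add hsum (hid.const_mul _), integral_const_mul, hmean]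
    simp
  · have htop {f : ℝ → ℝ} (hf : Measurable f) (hf0 : ∀ e, 0 ≤ f e)
        (hfi : ¬ Integrable f ν) : ∫⁻ e, ENNReal.ofReal (f e) ∂ν = ⊤ := by
      by_contra hne
      exact hfi ((lintegral_ofReal_ne_top_iff_integrable hf.aestronglyMeasurable
        (ae_of_all _ hf0)).1 hne)
    rw [htop (by fun_prop) (fun e => sq_nonneg _), htop (by fun_prop) (fun e => by positivity)]
    · intro hi
      refine h ((memLp_two_iff_integrable_sq (by fun_prop)).2 (hi.mono' (by fun_prop) ?_))
      exact ae_of_all _ fun e => by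
        rw [Real.norm_of_nonneg (sq_nonneg e)]
        nlinarith [sq_nonneg c]
    · intro hi
      have h' := (memLp_two_iff_integrable_sq (by fun_prop)).2 hi
      exact h (by simpa [Pi.sub_def] using h'.sub (memLp_const c))

section Proportions

variable {νa : Measure (Fin K → ℝ)} [IsProbabilityMeasure νa] {i : Fin K} {r v : ℝ}

lemma memLp_proportion_sub (hbdd : ∃ M : ℝ, ∀ᵐ a ∂νa, ∀ i, |a i| ≤ M) (i : Fin K) (r : ℝ) :
    MemLp (fun a : Fin K → ℝ => a i - r) 2 νa := by
  obtain ⟨M, hM⟩ := hbdd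
  exact (MemLp.of_bound (f := fun a : Fin K → ℝ => a i)
    (measurable_pi_apply i).aestronglyMeasurable M
    (hM.mono fun a ha => ha i)).sub (memLp_const r)

lemma memLp_proportion_sub_pi (hbdd : ∃ M : ℝ, ∀ᵐ a ∂νa, ∀ i, |a i| ≤ M) (i : Fin K) (r : ℝ)
    (j : Fin n) :
    MemLp (fun a : Fin n → Fin K → ℝ => a j i - r) 2 (Measure.pi fun _ => νa) :=
  (memLp_proportion_sub hbdd i r).comp_measurePreserving (measurePreserving_eval (fun _ => νa) j)

lemma integral_proportion_sub_mul (hbdd : ∃ M : ℝ, ∀ᵐ a ∂νa, ∀ i, |a i| ≤ M)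
    (hmean : ∫ a, a i ∂νa = r) (hvar : ∫ a, (a i - r) ^ 2 ∂νa = v) (j k : Fin n) :
    ∫ a : Fin n → Fin K → ℝ, (a j i - r) * (a k i - r) ∂(Measure.pi fun _ => νa) =
      if j = k then v else 0 := by
  have hcomp (f : (Fin K → ℝ) → ℝ) (hf : Measurable f) (j : Fin n) :
      ∫ a : Fin n → Fin K → ℝ, f (a j) ∂(Measure.pi fun _ => νa) = ∫ a, f a ∂νa :=
    integral_comp_eval (μ := fun _ : Fin n => νa) hf.aestronglyMeasurable
  split_ifs with hjk
  · subst hjk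
    rw [← hvar, ← hcomp _ (by fun_prop) j]
    simp only [sq]
  · have hX : Measurable fun a : Fin K → ℝ => a i - r := by fun_prop
    have hind := (iIndepFun_pi (μ := fun _ : Fin n => νa)
      (X := fun _ (a : Fin K → ℝ) => a i - r) fun _ => hX.aemeasurable).indepFun hjk
    rw [hind.integral_fun_mul_eq_mul_integral
        (hX.comp (measurable_pi_apply j)).aestronglyMeasurable
        (hX.comp (measurable_pi_apply k)).aestronglyMeasurable,
      hcomp (fun a => a i - r) (by fun_prop) j]
    have hint : Integrable (fun a : Fin K → ℝ => a i) νa := by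
      simpa using (memLp_proportion_sub hbdd i 0).integrable (by norm_num)
    simp [integral_sub hint (integrable_const r), hmean]

lemma lintegral_proportion_quadForm (hbdd : ∃ M : ℝ, ∀ᵐ a ∂νa, ∀ i, |a i| ≤ M)
    (hmean : ∫ a, a i ∂νa = r) (hvar : ∫ a, (a i - r) ^ 2 ∂νa = v) (m : Fin n → Fin n → ℝ)
    (hm : ∀ a : Fin n → Fin K → ℝ, 0 ≤ ∑ j, ∑ k, (a j i - r) * (a k i - r) * m j k) :
    ∫⁻ a, ENNReal.ofReal (∑ j, ∑ k, (a j i - r) * (a k i - r) * m j k)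
        ∂(Measure.pi fun _ : Fin n => νa) = ENNReal.ofReal (v * ∑ j, m j j) := by
  have hint (j k : Fin n) : Integrable (fun a : Fin n → Fin K → ℝ =>
      (a j i - r) * (a k i - r) * m j k) (Measure.pi fun _ => νa) :=
    ((memLp_proportion_sub_pi hbdd i r j).integrable_mul
      (memLp_proportion_sub_pi hbdd i r k)).mul_const _
  rw [← ofReal_integral_eq_lintegral_ofReal
    (integrable_finsetSum _ fun j _ => integrable_finsetSum _ fun k _ => hint j k)
    (ae_of_all _ hm)]
  congr 1
  rw [integral_finsetSum _ fun j _ => integrable_finsetSum _ fun k _ => hint j k, mul_sum]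
  refine Finset.sum_congr rfl fun j _ => ?_
  rw [integral_finsetSum _ fun k _ => hint j k]
  simp [integral_mul_const, integral_proportion_sub_mul hbdd hmean hvar]

end Proportions

lemma lintegral_noise_weighted_sum (ν : Measure ℝ) [IsProbabilityMeasure ν] {f : Fin n → ℝ → ℝ}
    (hf : ∀ j, Measurable (f j)) (hf0 : ∀ j e, 0 ≤ f j e) {q : Fin n → ℝ} (hq : ∀ j, 0 ≤ q j) :
    ∫⁻ η : Fin n → ℝ, ENNReal.ofReal (∑ j, f j (η j) * q j) ∂(Measure.pi fun _ => ν) =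
      ∑ j, (∫⁻ e, ENNReal.ofReal (f j e) ∂ν) * ENNReal.ofReal (q j) := by
  have hfm (j : Fin n) := (hf j).ennreal_ofReal
  simp_rw [ENNReal.ofReal_sum_of_nonneg fun j _ => mul_nonneg (hf0 j _) (hq j),
    fun j e => ENNReal.ofReal_mul (q := q j) (hf0 j e)]
  rw [lintegral_finsetSum _ fun j _ => by fun_prop]
  refine Finset.sum_congr rfl fun j _ => ?_
  rw [lintegral_mul_const _ (by fun_prop)]
  congr 1
  exact (measurePreserving_eval (fun _ : Fin n => ν) j).lintegral_comp (hfm j)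

/-- In the two-level hierarchical linear regression model, for each
child `i`,
`E[(θ̂ᵇ_i − p_i θ̂₀)ᵀ Σ (θ̂ᵇ_i − p_i θ̂₀)]
  = s_i · E[∑ j, ((θ₀ᵀx_j)² + η_j²) · x_jᵀ S⁻¹ Σ S⁻¹ x_j]`. -/
theorem bottomUp_variance_term_eq
    (d n K : ℕ) (hd : 1 ≤ d) (hn : d + 2 ≤ n)
    (C : Matrix (Fin d) (Fin d) ℝ) (hC : C.PosDef)
    (θ₀ : Fin d → ℝ) (σ : ℝ)
    (νx : Measure (Fin d → ℝ)) (νη : Measure ℝ) (νa : Measure (Fin K → ℝ))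
    [IsProbabilityMeasure νη] [IsProbabilityMeasure νa]
    (hx : IsCenteredGaussian νx C)
    (hηmean : ∫ e, e ∂νη = 0)
    (hηvar : ∫ e, e ^ 2 ∂νη = σ ^ 2)
    (p s : Fin K → ℝ)
    (hamean : ∀ i, ∫ v, v i ∂νa = p i)
    (havar : ∀ i, ∫ v, (v i - p i) ^ 2 ∂νa = s i)
    (habdd : ∃ M : ℝ, ∀ᵐ v ∂νa, ∀ i, |v i| ≤ M)
    (i : Fin K) :
    ∫ ω, (thetaBU θ₀ i ω - p i • thetaRoot θ₀ ω) ⬝ᵥ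
        C.mulVec (thetaBU θ₀ i ω - p i • thetaRoot θ₀ ω)
      ∂(hierMeasure d n K νx νη νa) =
      s i * ∫ ω, ∑ j, ((θ₀ ⬝ᵥ ω.1 j) ^ 2 + ω.2.1 j ^ 2) *
          (ω.1 j ⬝ᵥ ((Smat ω)⁻¹ * C * (Smat ω)⁻¹).mulVec (ω.1 j))
        ∂(hierMeasure d n K νx νη νa) := by
  have : IsProbabilityMeasure νx := by
    obtain ⟨A, -, rfl⟩ := hx
    have : IsProbabilityMeasure (stdGaussianPi d) := by unfold stdGaussianPi; infer_instance
    exact Measure.isProbabilityMeasure_map (by fun_prop)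
  have hs : 0 ≤ s i := havar i ▸ integral_nonneg fun v => sq_nonneg _
  have hq (x : Fin n → Fin d → ℝ) (j : Fin n) := olsWeight_self_nonneg hC.posSemidef x j
  have hw := measurable_olsWeight (n := n) C
  have hF0 (ω : HierOmega d n K) : 0 ≤ ∑ j, ∑ k, (ω.2.2 j i - p i) * (ω.2.2 k i - p i) *
      (yRoot θ₀ j ω * yRoot θ₀ k ω * olsWeight C ω.1 j k) := by
    rw [← thetaBU_sub_quadForm]
    simpa using hC.posSemidef.dotProduct_mulVec_nonneg (thetaBU θ₀ i ω - p i • thetaRoot θ₀ ω)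
  have hy (j : Fin n) : Measurable fun ω : HierOmega d n K => yRoot θ₀ j ω := by
    simp only [yRoot, dotProduct]
    fun_prop
  have hdot (j : Fin n) : Measurable fun ω : HierOmega d n K => θ₀ ⬝ᵥ ω.1 j := by
    simp only [dotProduct]
    fun_prop
  have hF : Measurable fun ω : HierOmega d n K => ∑ j, ∑ k, (ω.2.2 j i - p i) *
      (ω.2.2 k i - p i) * (yRoot θ₀ j ω * yRoot θ₀ k ω * olsWeight C ω.1 j k) := by
    fun_prop
  have hG : Measurable fun ω : HierOmega d n K =>
      ∑ j, ((θ₀ ⬝ᵥ ω.1 j) ^ 2 + ω.2.1 j ^ 2) * olsWeight C ω.1 j j := by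
    fun_prop
  simp_rw [thetaBU_sub_quadForm, olsWeight_self]
  rw [integral_eq_lintegral_of_nonneg_ae (ae_of_all _ hF0) hF.aestronglyMeasurable,
    integral_eq_lintegral_of_nonneg_ae
      (ae_of_all _ fun ω => Finset.sum_nonneg fun j _ => mul_nonneg (by positivity) (hq ω.1 j))
      hG.aestronglyMeasurable,
    ← ENNReal.toReal_ofReal_mul _ _ hs,
    ← lintegral_const_mul _ hG.ennreal_ofReal]
  congr 1
  unfold hierMeasure
  rw [lintegral_prod _ (by fun_prop), lintegral_prod _ (by fun_prop)]
  refine lintegral_congr fun x => ?_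
  rw [lintegral_prod _ (by fun_prop), lintegral_prod _ (by fun_prop)]
  have ha (η : Fin n → ℝ) := lintegral_proportion_quadForm habdd (hamean i) (havar i)
    (fun j k => (θ₀ ⬝ᵥ x j + η j) * (θ₀ ⬝ᵥ x k + η k) * olsWeight C x j k)
    fun a => hF0 (x, η, a)
  simp only [yRoot, ha, lintegral_const, measure_univ, mul_one, ENNReal.ofReal_mul hs, ← sq]
  rw [lintegral_const_mul _ (by fun_prop), lintegral_const_mul _ (by fun_prop)]
  congr 1
  rw [lintegral_noise_weighted_sum νη (f := fun j e => (θ₀ ⬝ᵥ x j + e) ^ 2)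
      (fun j => by fun_prop) (fun j e => sq_nonneg _) (hq x),
    lintegral_noise_weighted_sum νη (f := fun j e => (θ₀ ⬝ᵥ x j) ^ 2 + e ^ 2)
      (fun j => by fun_prop) (fun j e => by positivity) (hq x)]
  simp_rw [lintegral_const_add_sq νη hηmean]
end
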